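/- arXiv:math/0610654 — 2 statements merged into one kernel-verified Lean document; each statement's English description precedes it below -/
import Mathlib

section
/- Let G=(V,E) be a mixed graph and let A, B, S be pairwise disjoint subsets of V. Then A and B are p-separated given S in the marginal ancestral graph G_[an(A∪B∪S)] if and only if there exist subsets A' and B' with A⊆A', B⊆B', A' and B' disjoint from each other and from S, A'∪B'∪S=an(A∪B∪S), and A' and B' are p-separated given S in G_[an(A∪B∪S)]. -/
open MeasureTheory ProbabilityTheory Filter

noncomputable section

namespace GraphicalTS

/-! ### Mixed graphs, paths and p-separation -/

/-- A mixed graph on vertex type `V`, with directed edges `dir a b` (i.e. `a → b`)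
and (symmetric) undirected edges `undir a b` (i.e. `a — b`). -/
structure MixedGraph (V : Type*) where
  dir : V → V → Prop
  undir : V → V → Prop
  undir_symm : ∀ a b, undir a b → undir b a

namespace MixedGraph

variable {V : Type*}

/-- Parents of a set `A`: vertices `v ∉ A` with `v → a` for some `a ∈ A`. -/
def pa (G : MixedGraph V) (A : Set V) : Set V := {v | ∃ a ∈ A, G.dir v a} \ A

/-- Neighbours of a set `A`: vertices `v ∉ A` with `v — a` for some `a ∈ A`. -/
def nb (G : MixedGraph V) (A : Set V) : Set V := {v | ∃ a ∈ A, G.undir v a} \ A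

/-- Children of a set `A`: vertices `v ∉ A` with `a → v` for some `a ∈ A`. -/
def ch (G : MixedGraph V) (A : Set V) : Set V := {v | ∃ a ∈ A, G.dir a v} \ A

/-- `b` is an ancestor of `a`: `b = a` or there is a directed path `b → ⋯ → a`. -/
def ancestor (G : MixedGraph V) (b a : V) : Prop := Relation.ReflTransGen G.dir b a

/-- The set of ancestors of elements of `A`. -/
def anc (G : MixedGraph V) (A : Set V) : Set V := {b | ∃ a ∈ A, G.ancestor b a}

end MixedGraph

/-- The orientation of an edge as traversed along a path: forward directed (tail at the
current vertex, arrowhead at the next), backward directed, or undirected. -/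
inductive EdgeKind : Type
  | fwd | bwd | un

/-- A path between `a` and `b` in the mixed graph `G`: a sequence of `n` edges along
vertices `vert 0 = a, vert 1, …, vert n = b`; vertices and edges may repeat.
(`vert` and `kind` are total functions on `ℕ`; only the values `vert 0,…,vert n` and
`kind 0,…,kind (n-1)` are constrained.) -/
structure MGPath {V : Type*} (G : MixedGraph V) (a b : V) where
  n : ℕ
  vert : ℕ → V
  kind : ℕ → EdgeKind
  src : vert 0 = a
  tgt : vert n = b
  valid : ∀ i, i < n →
    (kind i = EdgeKind.fwd → G.dir (vert i) (vert (i + 1))) ∧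
    (kind i = EdgeKind.bwd → G.dir (vert (i + 1)) (vert i)) ∧
    (kind i = EdgeKind.un → G.undir (vert i) (vert (i + 1)))

namespace MGPath

variable {V : Type*} {G : MixedGraph V} {a b : V}

/-- The intermediate vertex at position `j` (for `0 < j < n`) is a p-collider: the two
adjacent edges form `→ c ←`, `→ c —` or `— c ←`. -/
def colliderAt (p : MGPath G a b) (j : ℕ) : Prop :=
  p.kind (j - 1) ≠ EdgeKind.bwd ∧ p.kind j ≠ EdgeKind.fwd ∧
    ¬(p.kind (j - 1) = EdgeKind.un ∧ p.kind j = EdgeKind.un)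

/-- The path is p-connecting given `S`: every intermediate p-noncollider is outside `S`
and every intermediate p-collider is in `S`. -/
def pConnecting (p : MGPath G a b) (S : Set V) : Prop :=
  ∀ j, 0 < j → j < p.n →
    (p.colliderAt j → p.vert j ∈ S) ∧ (¬p.colliderAt j → p.vert j ∉ S)

/-- The path has an arrowhead at its endpoint `b`. -/
def bPointing (p : MGPath G a b) : Prop :=
  0 < p.n ∧ p.kind (p.n - 1) = EdgeKind.fwd

/-- The path has arrowheads at both endpoints. -/
def biPointing (p : MGPath G a b) : Prop :=
  0 < p.n ∧ p.kind 0 = EdgeKind.bwd ∧ p.kind (p.n - 1) = EdgeKind.fwd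

/-- The path consists of undirected edges only. -/
def undirected (p : MGPath G a b) : Prop := ∀ i, i < p.n → p.kind i = EdgeKind.un

/-- The path is a composition of finitely many subpaths, each of which is undirected
or bi-pointing (cut points `c 0 = 0 < c 1 < ⋯ < c m = n`). -/
def extBiPointing (p : MGPath G a b) : Prop :=
  ∃ (m : ℕ) (c : ℕ → ℕ), c 0 = 0 ∧ c m = p.n ∧ (∀ k, k < m → c k < c (k + 1)) ∧
    ∀ k, k < m →
      (∀ i, c k ≤ i → i < c (k + 1) → p.kind i = EdgeKind.un) ∨
      (p.kind (c k) = EdgeKind.bwd ∧ p.kind (c (k + 1) - 1) = EdgeKind.fwd)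

/-- Every intermediate vertex on the path is a p-collider. -/
def pureCollider (p : MGPath G a b) : Prop := ∀ j, 0 < j → j < p.n → p.colliderAt j

/-- The path is a trail: all intermediate vertices are distinct. -/
def isTrail (p : MGPath G a b) : Prop :=
  ∀ i j, 0 < i → i < p.n → 0 < j → j < p.n → p.vert i = p.vert j → i = j

/-- The trail is p-active relative to `S` (Andersson–Madigan–Perlman): every p-collider
lies in `an(S)`, and every p-noncollider `v` either lies outside `S`, or its two adjacent
edges are undirected and `pa(v) ∖ S ≠ ∅`. -/
def pActive (p : MGPath G a b) (S : Set V) : Prop :=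
  ∀ j, 0 < j → j < p.n →
    (p.colliderAt j → p.vert j ∈ G.anc S) ∧
    (¬p.colliderAt j →
      p.vert j ∉ S ∨
        (p.kind (j - 1) = EdgeKind.un ∧ p.kind j = EdgeKind.un ∧
          ({v | G.dir v (p.vert j)} \ S).Nonempty))

end MGPath

/-- `A` and `B` are p-separated given `S`: every path between a vertex of `A` and a
vertex of `B` is p-blocked given `S`. -/
def pSeparated {V : Type*} (G : MixedGraph V) (A B S : Set V) : Prop :=
  ∀ a ∈ A, ∀ b ∈ B, ∀ p : MGPath G a b, ¬p.pConnecting S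

/-- `a` and `b` are joined in `G` by an undirected path none of whose intermediate
vertices lies in `an(W) ∖ {a, b}`. -/
def undirAvoiding {V : Type*} (G : MixedGraph V) (W : Set V) (a b : V) : Prop :=
  ∃ p : MGPath G a b, 0 < p.n ∧ p.undirected ∧
    ∀ j, 0 < j → j < p.n → p.vert j ∉ G.anc W \ {a, b}

/-- The marginal ancestral graph `G_[A]` (for an ancestral set `A`): the subgraph of `G`
induced by `A`, together with an additional undirected edge `a — b` for each pair
`a, b ∈ A` joined in `G` by an undirected path avoiding `an(A) ∖ {a, b}`. -/
def marginalGraph {V : Type*} (G : MixedGraph V) (A : Set V) : MixedGraph V where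
  dir u v := G.dir u v ∧ u ∈ A ∧ v ∈ A
  undir u v := (G.undir u v ∧ u ∈ A ∧ v ∈ A) ∨
    (u ∈ A ∧ v ∈ A ∧ (undirAvoiding G A u v ∨ undirAvoiding G A v u))
  undir_symm := by
    rintro x y (⟨h, hx, hy⟩ | ⟨hx, hy, h⟩)
    · exact Or.inl ⟨G.undir_symm _ _ h, hy, hx⟩
    · exact Or.inr ⟨hy, hx, h.symm⟩

/-! ### σ-algebras, conditional independence, Granger causality -/

variable {Ω : Type*}

/-- The `μ`-completion of a sub-σ-algebra `m`: the σ-algebra generated by `m` together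
with all `μ`-null sets. -/
def mComplete [MeasurableSpace Ω] (μ : Measure Ω) (m : MeasurableSpace Ω) :
    MeasurableSpace Ω :=
  m ⊔ MeasurableSpace.generateFrom {s : Set Ω | μ s = 0}

/-- `ℱ_A(t)`: the `μ`-completed σ-algebra generated by `{X_a(s) : a ∈ A, s ≤ t}`. -/
def pastSigma {V : Type*} [MeasurableSpace Ω] (μ : Measure Ω) (X : V → ℤ → Ω → ℝ)
    (A : Set V) (t : ℤ) : MeasurableSpace Ω :=
  mComplete μ (⨆ a ∈ A, ⨆ s ≤ t, MeasurableSpace.comap (X a s) inferInstance)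

/-- Conditional independence `m₁ ⟂ m₂ | m₃` of sub-σ-algebras:
`E[1_G | m₂ ∨ m₃] = E[1_G | m₃]` a.s. for every `G ∈ m₁`. -/
def CondIndepSigma [MeasurableSpace Ω] (μ : Measure Ω) (m₁ m₂ m₃ : MeasurableSpace Ω) :
    Prop :=
  ∀ s : Set Ω, MeasurableSet[m₁] s →
    μ[s.indicator fun _ => (1 : ℝ) | m₂ ⊔ m₃] =ᵐ[μ] μ[s.indicator fun _ => (1 : ℝ) | m₃]

/-- `X_A` is (strongly) Granger-noncausal for `X_B` with respect to `ℱ_S`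
(`X_A ⇸ X_B [ℱ_S]`): `ℱ_B(t+1) ⟂ ℱ_A(t) | ℱ_{S∖A}(t)` for all `t`. -/
def GrangerNoncausal {V : Type*} [MeasurableSpace Ω] (μ : Measure Ω)
    (X : V → ℤ → Ω → ℝ) (A B S : Set V) : Prop :=
  ∀ t : ℤ, CondIndepSigma μ (pastSigma μ X B (t + 1)) (pastSigma μ X A t)
    (pastSigma μ X (S \ A) t)

/-- `X_A` and `X_B` are contemporaneously conditionally independent with respect to
`ℱ_S` (`X_A ≁ X_B [ℱ_S]`): `ℱ_A(t+1) ⟂ ℱ_B(t+1) | ℱ_S(t) ∨ ℱ_{S∖(A∪B)}(t+1)`. -/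
def ContempIndep {V : Type*} [MeasurableSpace Ω] (μ : Measure Ω)
    (X : V → ℤ → Ω → ℝ) (A B S : Set V) : Prop :=
  ∀ t : ℤ, CondIndepSigma μ (pastSigma μ X A (t + 1)) (pastSigma μ X B (t + 1))
    (pastSigma μ X S t ⊔ pastSigma μ X (S \ (A ∪ B)) (t + 1))

/-! ### Granger-causal Markov properties (ground set `W`, usually `W = Set.univ`) -/

/-- (PC) the pairwise Granger-causal Markov property w.r.t. `G` (on ground set `W`). -/
def PairwiseMarkov {V : Type*} [MeasurableSpace Ω] (μ : Measure Ω)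
    (X : V → ℤ → Ω → ℝ) (G : MixedGraph V) (W : Set V) : Prop :=
  ∀ a ∈ W, ∀ b ∈ W, a ≠ b →
    (¬G.dir a b → GrangerNoncausal μ X {a} {b} W) ∧
    (¬G.undir a b → ContempIndep μ X {a} {b} W)

/-- (LC) the local Granger-causal Markov property w.r.t. `G` (on ground set `W`). -/
def LocalMarkov {V : Type*} [MeasurableSpace Ω] (μ : Measure Ω)
    (X : V → ℤ → Ω → ℝ) (G : MixedGraph V) (W : Set V) : Prop :=
  ∀ a ∈ W,
    GrangerNoncausal μ X (W \ (G.pa {a} ∪ {a})) {a} W ∧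
    ContempIndep μ X (W \ (G.nb {a} ∪ {a})) {a} W

/-- (BC) the block-recursive Granger-causal Markov property w.r.t. `G`
(on ground set `W`). -/
def BlockRecursiveMarkov {V : Type*} [MeasurableSpace Ω] (μ : Measure Ω)
    (X : V → ℤ → Ω → ℝ) (G : MixedGraph V) (W : Set V) : Prop :=
  ∀ A ⊆ W,
    GrangerNoncausal μ X (W \ (G.pa A ∪ A)) A W ∧
    ContempIndep μ X (W \ (G.nb A ∪ A)) A W

/-- (GC) the global Granger-causal Markov property w.r.t. `G`. -/
def GlobalMarkov {V : Type*} [MeasurableSpace Ω] (μ : Measure Ω)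
    (X : V → ℤ → Ω → ℝ) (G : MixedGraph V) : Prop :=
  ∀ A B S : Set V, Disjoint A B → Disjoint A S → Disjoint B S →
    ((∀ a ∈ A, ∀ b ∈ B, ∀ p : MGPath G a b, p.bPointing → ¬p.pConnecting (S ∪ B)) →
      GrangerNoncausal μ X A B (A ∪ B ∪ S)) ∧
    ((∀ a ∈ A, ∀ b ∈ B, ∀ p : MGPath G a b, p.extBiPointing →
        ¬p.pConnecting (A ∪ B ∪ S)) →
      ContempIndep μ X A B (A ∪ B ∪ S))

/-! ### Conditions (M) and (P) -/

/-- Stationarity: the joint law of `(X_V(t+s))_{s∈ℤ}` does not depend on `t`. -/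
def Stationary {V : Type*} [MeasurableSpace Ω] (μ : Measure Ω)
    (X : V → ℤ → Ω → ℝ) : Prop :=
  ∀ t : ℤ,
    Measure.map (fun ω => fun q : ℤ × V => X q.2 (t + q.1) ω) μ =
    Measure.map (fun ω => fun q : ℤ × V => X q.2 q.1 ω) μ

/-- Strong mixing: `sup |P(S₁ ∩ S₂) − P(S₁) P(S₂)| → 0` as `k → ∞`, the supremum being
over `S₁ ∈ σ(X_V(s) : s ≤ t)` and `S₂ ∈ σ(X_V(s) : s ≥ t + k)`. -/
def StrongMixing {V : Type*} [MeasurableSpace Ω] (μ : Measure Ω)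
    (X : V → ℤ → Ω → ℝ) : Prop :=
  ∀ t : ℤ, ∀ ε > (0 : ℝ), ∃ K : ℕ, ∀ k : ℕ, K ≤ k → ∀ S₁ S₂ : Set Ω,
    MeasurableSet[⨆ (v : V), ⨆ s ≤ t, MeasurableSpace.comap (X v s) inferInstance] S₁ →
    MeasurableSet[⨆ (v : V), ⨆ (s : ℤ) (_ : t + k ≤ s),
      MeasurableSpace.comap (X v s) inferInstance] S₂ →
    |(μ (S₁ ∩ S₂)).toReal - (μ S₁).toReal * (μ S₂).toReal| ≤ ε

/-- Condition (M): the process is stationary and strongly mixing. -/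
def ConditionM {V : Type*} [MeasurableSpace Ω] (μ : Measure Ω)
    (X : V → ℤ → Ω → ℝ) : Prop :=
  Stationary μ X ∧ StrongMixing μ X

/-- `ν` is a product measure on `ℝ^V`. -/
def IsProductMeasure {V : Type*} [Fintype V] (ν : Measure (V → ℝ)) : Prop :=
  ∃ νv : V → Measure ℝ, ∀ B : V → Set ℝ, (∀ v, MeasurableSet (B v)) →
    ν (Set.univ.pi B) = ∏ v, νv v (B v)

/-- The past trajectory `(X_V(s))_{s ≤ t}` of the process at time `t`. -/
def pastTraj {V : Type*} (X : V → ℤ → Ω → ℝ) (t : ℤ) (ω : Ω) : ℤ → V → ℝ :=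
  fun s v => if s ≤ t then X v s ω else 0

/-- Condition (P): the conditional distribution of `X_V(t+1)` given the past
`(X_V(s))_{s≤t}` has a regular version (a Markov kernel `κ` applied to the past
trajectory) that is almost surely absolutely continuous with respect to some product
measure `ν` on `ℝ^V` with a `ν`-a.e. positive and continuous density `f`. -/
def ConditionP {V : Type*} [Fintype V] [MeasurableSpace Ω] (μ : Measure Ω)
    (X : V → ℤ → Ω → ℝ) : Prop :=
  ∃ ν : Measure (V → ℝ), IsProductMeasure ν ∧
    ∀ t : ℤ, ∃ (κ : Kernel (ℤ → V → ℝ) (V → ℝ)) (f : (ℤ → V → ℝ) → (V → ℝ) → ℝ),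
      IsMarkovKernel κ ∧
      (∀ B : Set (V → ℝ), MeasurableSet B →
        (μ[fun ω => B.indicator (fun _ => (1 : ℝ)) (fun v => X v (t + 1) ω) |
            pastSigma μ X Set.univ t]) =ᵐ[μ]
          fun ω => (κ (pastTraj X t ω) B).toReal) ∧
      (∀ᵐ ω ∂μ,
        κ (pastTraj X t ω) =
          ν.withDensity (fun y => ENNReal.ofReal (f (pastTraj X t ω) y)) ∧
        (∀ᵐ y ∂ν, 0 < f (pastTraj X t ω) y ∧ ContinuousAt (f (pastTraj X t ω)) y))


/-! ### One-edge-at-a-time description of p-connecting paths -/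

namespace MixedGraph

variable {V : Type*}

/-- `G` has an edge of kind `l` when traversed from `v` to `w`. -/
def HasEdge (G : MixedGraph V) : EdgeKind → V → V → Prop
  | .fwd, v, w => G.dir v w
  | .bwd, v, w => G.dir w v
  | .un, v, w => G.undir v w

end MixedGraph

/-- A vertex entered by an edge of kind `k` and left by an edge of kind `l` is a p-collider. -/
def IsPCollider (k l : EdgeKind) : Prop :=
  k ≠ EdgeKind.bwd ∧ l ≠ EdgeKind.fwd ∧ ¬(k = EdgeKind.un ∧ l = EdgeKind.un)

/-- `PReach G S a v k`: there is a p-connecting path given `S` from `a` to `v` whose last edge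
has kind `k`; the trivial path counts as ending in a backward edge, which is the kind that
makes its end a p-noncollider in every continuation. -/
inductive PReach {V : Type*} (G : MixedGraph V) (S : Set V) (a : V) : V → EdgeKind → Prop
  | refl : PReach G S a a EdgeKind.bwd
  | step {v w : V} {k l : EdgeKind} : PReach G S a v k → G.HasEdge l v w →
      (IsPCollider k l ↔ v ∈ S) → PReach G S a w l

namespace MGPath

variable {V : Type*} {G : MixedGraph V} {a v w : V} {S : Set V}

theorem hasEdge (p : MGPath G a v) {i : ℕ} (hi : i < p.n) :
    G.HasEdge (p.kind i) (p.vert i) (p.vert (i + 1)) := by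
  obtain ⟨h₁, h₂, h₃⟩ := p.valid i hi
  cases h : p.kind i
  · exact h₁ h
  · exact h₂ h
  · exact h₃ h

/-- The path without edges. -/
def trivial (G : MixedGraph V) (a : V) : MGPath G a a where
  n := 0
  vert _ := a
  kind _ := EdgeKind.un
  src := rfl
  tgt := rfl
  valid i hi := absurd hi (Nat.not_lt_zero i)

/-- Append an edge at the end of a path. -/
def snoc (p : MGPath G a v) (l : EdgeKind) (h : G.HasEdge l v w) : MGPath G a w where
  n := p.n + 1
  vert i := if i ≤ p.n then p.vert i else w
  kind i := if i < p.n then p.kind i else l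
  src := by simp [p.src]
  tgt := by simp
  valid i hi := by
    rcases Nat.lt_succ_iff_lt_or_eq.mp hi with hi' | rfl
    · simpa [hi', hi'.le, Nat.succ_le_iff] using p.valid i hi'
    · cases l <;> simpa [p.tgt, MixedGraph.HasEdge] using h

theorem pConnecting_iff (p : MGPath G a v) :
    p.pConnecting S ↔
      ∀ j, j + 1 < p.n → (IsPCollider (p.kind j) (p.kind (j + 1)) ↔ p.vert (j + 1) ∈ S) := by
  constructor
  · intro h j hj
    obtain ⟨h₁, h₂⟩ := h (j + 1) j.succ_pos hj
    exact ⟨h₁, fun hS => by_contra fun hc => h₂ hc hS⟩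
  · rintro h (_ | j) hj hjn
    · exact absurd hj (lt_irrefl 0)
    · exact ⟨(h j hjn).1, fun hc hS => hc ((h j hjn).2 hS)⟩

/-- A p-connecting path can be attached to any p-connecting path ending in its source, if the
last edge of the latter points backward. -/
theorem exists_pReach {u : V} (p : MGPath G v u) (hp : p.pConnecting S) (hv : v ∉ S)
    (h : PReach G S a v EdgeKind.bwd) : ∃ k, PReach G S a u k := by
  rw [pConnecting_iff] at hp
  have key : ∀ i, i < p.n → PReach G S a (p.vert (i + 1)) (p.kind i) := by
    intro i
    induction i with
    | zero =>
      intro hi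
      have he := p.hasEdge hi
      rw [p.src] at he
      exact h.step he ⟨fun hc => absurd rfl hc.1, fun hS => absurd hS hv⟩
    | succ i ih =>
      intro hi
      exact (ih (Nat.lt_of_succ_lt hi)).step (p.hasEdge hi) (hp i hi)
  rcases Nat.eq_zero_or_pos p.n with h0 | hpos
  · have huv : v = u := p.src.symm.trans (h0 ▸ p.tgt)
    exact ⟨_, huv ▸ h⟩
  · have := key (p.n - 1) (by omega)
    rw [Nat.sub_add_cancel (show 1 ≤ p.n from hpos), p.tgt] at this
    exact ⟨_, this⟩

end MGPath

namespace PReach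

variable {V : Type*} {G : MixedGraph V} {a v w : V} {k : EdgeKind} {S : Set V}

theorem exists_path (h : PReach G S a v k) :
    ∃ p : MGPath G a v, p.pConnecting S ∧ (0 < p.n → p.kind (p.n - 1) = k) := by
  induction h with
  | refl =>
    exact ⟨MGPath.trivial G a, fun j _ hj => absurd hj (Nat.not_lt_zero j),
      fun h => absurd h (lt_irrefl 0)⟩
  | @step v w k l _ he hc ih =>
    obtain ⟨p, hp, hk⟩ := ih
    refine ⟨p.snoc l he, ?_, fun _ => by simp [MGPath.snoc]⟩
    rw [MGPath.pConnecting_iff] at hp ⊢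
    intro j hj
    have hj' : j + 1 ≤ p.n := Nat.lt_succ_iff.mp hj
    rcases hj'.lt_or_eq with hlt | heq
    · simpa [MGPath.snoc, hlt, hlt.le, Nat.lt_of_succ_lt hlt] using hp j hlt
    · have hk' : p.kind j = k := by
        rw [← hk (by omega), ← heq, Nat.add_sub_cancel]
      have hv : p.vert (j + 1) = v := by rw [heq, p.tgt]
      have hjn : j < p.n := by omega
      simpa [MGPath.snoc, hjn, heq.not_lt, heq.le, hk', hv] using hc

theorem step_fwd (h : PReach G S a v k) (hv : v ∉ S) (hvw : G.dir v w) :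
    PReach G S a w EdgeKind.fwd :=
  h.step hvw ⟨fun hc => absurd rfl hc.2.1, fun hS => absurd hS hv⟩

/-- If `A` and `B` are not connected, then a vertex outside `S` that reaches `A ∪ B ∪ S` by a
directed path and is p-connected with `A` is so by a path whose last edge points backward. -/
theorem exists_bwd {A B : Set V} (hAB : ∀ a ∈ A, ∀ b ∈ B, ∀ k, ¬PReach G S a b k) {z : V}
    (hz : z ∈ A ∪ B ∪ S) (hvz : Relation.ReflTransGen G.dir v z) :
    ∀ {a k}, a ∈ A → v ∉ S → PReach G S a v k → ∃ a' ∈ A, PReach G S a' v EdgeKind.bwd := by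
  induction hvz using Relation.ReflTransGen.head_induction_on with
  | refl =>
    intro a k ha hzS h
    rcases hz with (hzA | hzB) | hzS'
    · exact ⟨z, hzA, .refl⟩
    · exact absurd h (hAB a ha z hzB k)
    · exact absurd hzS' hzS
  | @head v w hvw _ ih =>
    intro a k ha hvS h
    have hw := h.step_fwd hvS hvw
    by_cases hwS : w ∈ S
    · exact ⟨a, ha, hw.step (l := EdgeKind.bwd) hvw (by simp [IsPCollider, hwS])⟩
    · obtain ⟨a', ha', h'⟩ := ih ha hwS hw
      exact ⟨a', ha', h'.step (l := EdgeKind.bwd) hvw (by simp [IsPCollider, hwS])⟩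

end PReach

theorem pSeparated_iff_not_pReach {V : Type*} {G : MixedGraph V} {A B S : Set V}
    (hAS : Disjoint A S) :
    pSeparated G A B S ↔ ∀ a ∈ A, ∀ b ∈ B, ∀ k, ¬PReach G S a b k := by
  constructor
  · intro h a ha b hb k hk
    obtain ⟨p, hp, -⟩ := hk.exists_path
    exact h a ha b hb p hp
  · intro h a ha b hb p hp
    obtain ⟨k, hk⟩ := p.exists_pReach hp (hAS.notMem_of_mem_left ha) .refl
    exact h a ha b hb k hk

theorem MixedGraph.subset_anc {V : Type*} (G : MixedGraph V) (W : Set V) : W ⊆ G.anc W :=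
  fun a ha => ⟨a, ha, .refl⟩

/-- Directed paths into `W` are kept by the marginal ancestral graph on `an(W)`. -/
theorem reflTransGen_marginalGraph {V : Type*} {G : MixedGraph V} {W : Set V} {v z : V}
    (hz : z ∈ W) (h : Relation.ReflTransGen G.dir v z) :
    Relation.ReflTransGen (marginalGraph G (G.anc W)).dir v z := by
  induction h using Relation.ReflTransGen.head_induction_on with
  | refl => exact .refl
  | head hvw hwz ih => exact ih.head ⟨hvw, ⟨z, hz, hwz.head hvw⟩, ⟨z, hz, hwz⟩⟩

/-- Lemma: completion of a p-separation to a partition of the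
ancestral set. For a mixed graph `G` and pairwise disjoint `A, B, S ⊆ V`: `A` and `B`
are p-separated given `S` in `G_[an(A∪B∪S)]` iff there are `A' ⊇ A` and `B' ⊇ B`,
disjoint from each other and from `S`, with `A' ∪ B' ∪ S = an(A∪B∪S)`, such that `A'`
and `B'` are p-separated given `S` in `G_[an(A∪B∪S)]`. -/
theorem pSeparation_full_partition
    {V : Type*} (G : MixedGraph V) (A B S : Set V)
    (hAB : Disjoint A B) (hAS : Disjoint A S) (hBS : Disjoint B S) :
    pSeparated (marginalGraph G (G.anc (A ∪ B ∪ S))) A B S ↔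
      ∃ A' B' : Set V, A ⊆ A' ∧ B ⊆ B' ∧
        Disjoint A' B' ∧ Disjoint A' S ∧ Disjoint B' S ∧
        A' ∪ B' ∪ S = G.anc (A ∪ B ∪ S) ∧
        pSeparated (marginalGraph G (G.anc (A ∪ B ∪ S))) A' B' S := by
  constructor
  · intro h
    set W := G.anc (A ∪ B ∪ S)
    set H := marginalGraph G W
    have hsub : A ∪ B ∪ S ⊆ W := G.subset_anc _
    rw [pSeparated_iff_not_pReach hAS] at h
    set A' : Set V := {v | v ∈ W ∧ v ∉ S ∧ ∃ a ∈ A, ∃ k, PReach H S a v k}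
    have hA'S : Disjoint A' S := Set.disjoint_left.mpr fun v hv => hv.2.1
    refine ⟨A', W \ (A' ∪ S), ?_, ?_, ?_, hA'S, ?_, ?_, ?_⟩
    · exact fun a ha =>
        ⟨hsub (.inl (.inl ha)), hAS.notMem_of_mem_left ha, a, ha, _, .refl⟩
    · refine fun b hb => ⟨hsub (.inl (.inr hb)), ?_⟩
      rintro (⟨-, -, a, ha, k, hk⟩ | hbS)
      · exact h a ha b hb k hk
      · exact hBS.notMem_of_mem_left hb hbS
    · exact Set.disjoint_left.mpr fun v hv hv' => hv'.2 (.inl hv)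
    · exact Set.disjoint_left.mpr fun v hv hvS => hv.2 (.inr hvS)
    · have hA'W : A' ∪ S ⊆ W :=
        Set.union_subset (fun v hv => hv.1) (Set.subset_union_right.trans hsub)
      rw [Set.union_right_comm, Set.union_sdiff_cancel hA'W]
    · rintro v ⟨⟨z, hz, hvz⟩, hvS, a, ha, k, hk⟩ u ⟨huW, hu⟩ p hp
      obtain ⟨a', ha', h'⟩ :=
        PReach.exists_bwd h hz (reflTransGen_marginalGraph hz hvz) ha hvS hk
      obtain ⟨l, hl⟩ := p.exists_pReach hp hvS h'
      exact hu (.inl ⟨huW, fun huS => hu (.inr huS), a', ha', l, hl⟩)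
  · rintro ⟨A', B', hA, hB, -, -, -, -, h⟩ a ha b hb
    exact h a (hA ha) b (hB hb)

end GraphicalTS
end
end

section
/- Let G=(V,E) be a mixed graph and let A and B be disjoint subsets of V. Then the following three statements are equivalent: (i) A and B are p-separated given V∖(A∪B); (ii) there is no pure-collider path between A and B, i.e., no path between a vertex of A and a vertex of B on which every intermediate vertex is a p-collider; (iii) (A∪ch(A))∩(B∪ch(B))=∅ and ne(A∪ch(A))∩(B∪ch(B))=∅. -/
open MeasureTheory ProbabilityTheory Filter

noncomputable section

namespace GraphicalTS

/-! ### σ-algebras, conditional independence, Granger causality -/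

variable {Ω : Type*}

namespace MGPath

variable {V : Type*} {G : MixedGraph V} {a b c : V}

/-- The subpath of `p` from position `k` to its end. -/
def drop (p : MGPath G a b) (k : ℕ) (hk : k ≤ p.n) : MGPath G (p.vert k) b where
  n := p.n - k
  vert i := p.vert (k + i)
  kind i := p.kind (k + i)
  src := rfl
  tgt := by rw [Nat.add_sub_cancel' hk, p.tgt]
  valid i hi := p.valid (k + i) (by omega)

/-- The subpath of `p` from its start to position `k`. -/
def take (p : MGPath G a b) (k : ℕ) (hk : k ≤ p.n) : MGPath G a (p.vert k) where
  n := k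
  vert := p.vert
  kind := p.kind
  src := p.src
  tgt := rfl
  valid i hi := p.valid i (by omega)

/-- The path of length zero at `a`. -/
def nil (G : MixedGraph V) (a : V) : MGPath G a a where
  n := 0
  vert _ := a
  kind _ := EdgeKind.un
  src := rfl
  tgt := rfl
  valid _ hi := absurd hi (Nat.not_lt_zero _)

/-- The path `p` extended by one edge of kind `k` at its start. -/
def cons (k : EdgeKind)
    (h : (k = EdgeKind.fwd → G.dir a b) ∧ (k = EdgeKind.bwd → G.dir b a) ∧
      (k = EdgeKind.un → G.undir a b))
    (p : MGPath G b c) : MGPath G a c where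
  n := p.n + 1
  vert i := Nat.casesOn i a p.vert
  kind i := Nat.casesOn i k p.kind
  src := rfl
  tgt := p.tgt
  valid i hi := by
    cases i with
    | zero => simpa [p.src] using h
    | succ i => exact p.valid i (by omega)

theorem colliderAt_drop (p : MGPath G a b) {k j : ℕ} (hk : k ≤ p.n) (hj : 0 < j) :
    (p.drop k hk).colliderAt j ↔ p.colliderAt (k + j) := by
  simp only [colliderAt, drop, Nat.add_sub_assoc (Nat.one_le_of_lt hj)]

theorem pureCollider_cons {k : EdgeKind}
    {h : (k = EdgeKind.fwd → G.dir a b) ∧ (k = EdgeKind.bwd → G.dir b a) ∧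
      (k = EdgeKind.un → G.undir a b)}
    {p : MGPath G b c} (hp : p.pureCollider)
    (h0 : 0 < p.n → k ≠ EdgeKind.bwd ∧ p.kind 0 ≠ EdgeKind.fwd ∧
      ¬(k = EdgeKind.un ∧ p.kind 0 = EdgeKind.un)) :
    (cons k h p).pureCollider := by
  intro j hj hjn
  obtain _ | _ | j := j
  · exact absurd hj (lt_irrefl 0)
  · exact h0 (Nat.lt_of_succ_lt_succ hjn)
  · exact hp (j + 1) j.succ_pos (Nat.lt_of_succ_lt_succ hjn)

/-- A path between `A` and `B` whose intermediate noncolliders all lie in `A ∪ B` contains a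
pure-collider subpath between `A` and `B` with no intermediate vertex in `A ∪ B`. -/
theorem exists_pureCollider_of_colliderAt_or_mem {A B : Set V} (ha : a ∈ A) (hb : b ∈ B)
    (p : MGPath G a b)
    (hp : ∀ j, 0 < j → j < p.n → p.colliderAt j ∨ p.vert j ∈ A ∪ B) :
    ∃ a' ∈ A, ∃ b' ∈ B, ∃ q : MGPath G a' b',
      q.pureCollider ∧ ∀ j, 0 < j → j < q.n → q.vert j ∉ A ∪ B := by
  induction hn : p.n using Nat.strong_induction_on generalizing a b with
  | _ n ih =>
    subst hn
    by_cases hmem : ∃ j, 0 < j ∧ j < p.n ∧ p.vert j ∈ A ∪ B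
    · obtain ⟨k, hk, hkn, hkA | hkB⟩ := hmem
      · refine ih (p.n - k) (by omega) hkA hb (p.drop k hkn.le) (fun j hj hjn => ?_) rfl
        rw [colliderAt_drop p hkn.le hj]
        have hjn' : j < p.n - k := hjn
        exact hp (k + j) (by omega) (by omega)
      · exact ih k hkn ha hkB (p.take k hkn.le)
          (fun j hj hjn => hp j hj (lt_trans hjn hkn)) rfl
    · push Not at hmem
      exact ⟨a, ha, b, hb, p,
        fun j hj hjn => (hp j hj hjn).resolve_right (hmem j hj hjn), hmem⟩

theorem pureCollider.n_le_three {p : MGPath G a b} (hp : p.pureCollider) : p.n ≤ 3 := by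
  by_contra! hn
  obtain ⟨-, h1, -⟩ := hp 1 (by omega) (by omega)
  obtain ⟨h2, h3, h4⟩ := hp 2 (by omega) (by omega)
  obtain ⟨h5, -, -⟩ := hp 3 (by omega) (by omega)
  simp only [Nat.add_one_sub_one] at h1 h2 h3 h4 h5
  cases e1 : p.kind 1 <;> cases e2 : p.kind 2 <;> simp_all

end MGPath

theorem MixedGraph.mem_union_ch_iff {V : Type*} {G : MixedGraph V} {A : Set V} {x : V} :
    x ∈ A ∪ G.ch A ↔ x ∈ A ∨ ∃ a ∈ A, G.dir a x := by
  simp only [MixedGraph.ch, Set.mem_union, Set.mem_sdiff, Set.mem_ofPred_eq]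
  tauto

/-- Disjointness of `S` from `T` and of the neighbours of `S` from `T` means that no vertex of `S`
is equal to or a neighbour of a vertex of `T`. -/
theorem MixedGraph.inter_eq_empty_and_nb_inter_eq_empty_iff {V : Type*} {G : MixedGraph V}
    {S T : Set V} :
    S ∩ T = ∅ ∧ G.nb S ∩ T = ∅ ↔ ∀ x ∈ S, ∀ y ∈ T, ¬(x = y ∨ G.undir x y) := by
  simp only [Set.eq_empty_iff_forall_notMem, Set.mem_inter_iff, MixedGraph.nb, Set.mem_sdiff,
    Set.mem_ofPred_eq]
  constructor
  · rintro ⟨h1, h2⟩ x hx y hy (rfl | h)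
    · exact h1 x ⟨hx, hy⟩
    · exact h2 y ⟨⟨⟨x, hx, G.undir_symm _ _ h⟩, fun hyS => h1 y ⟨hyS, hy⟩⟩, hy⟩
  · intro h
    refine ⟨fun x hx => h x hx.1 x hx.2 (Or.inl rfl), ?_⟩
    rintro y ⟨⟨⟨x, hx, hxy⟩, -⟩, hy⟩
    exact h x hx y hy (Or.inr (G.undir_symm _ _ hxy))

/-- A pure-collider path between `A` and `B` exists iff some vertex in `A ∪ ch(A)` is equal to or
a neighbour of a vertex in `B ∪ ch(B)`. -/
theorem exists_pureCollider_iff {V : Type*} {G : MixedGraph V} {A B : Set V} :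
    (∃ a ∈ A, ∃ b ∈ B, ∃ p : MGPath G a b, p.pureCollider) ↔
      ∃ x ∈ A ∪ G.ch A, ∃ y ∈ B ∪ G.ch B, x = y ∨ G.undir x y := by
  simp only [MixedGraph.mem_union_ch_iff]
  constructor
  · rintro ⟨a, ha, b, hb, p, hp⟩
    have hn := hp.n_le_three
    have hsrc := p.src
    have htgt := p.tgt
    have hval := p.valid
    have hcol : ∀ j, 0 < j → j < p.n → p.colliderAt j := hp
    simp only [MGPath.colliderAt] at hcol
    generalize p.n = n at *
    interval_cases n
    · exact ⟨a, Or.inl ha, b, Or.inl hb, Or.inl (hsrc.symm.trans htgt)⟩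
    · have v0 := hval 0 (by omega)
      simp only [zero_add, hsrc, htgt] at v0
      cases e0 : p.kind 0 <;> simp [e0] at v0
      · exact ⟨b, Or.inr ⟨a, ha, v0⟩, b, Or.inl hb, Or.inl rfl⟩
      · exact ⟨a, Or.inl ha, a, Or.inr ⟨b, hb, v0⟩, Or.inl rfl⟩
      · exact ⟨a, Or.inl ha, b, Or.inl hb, Or.inr v0⟩
    · have v0 := hval 0 (by omega)
      have v1 := hval 1 (by omega)
      have c1 := hcol 1 (by omega) (by omega)
      simp only [zero_add, Nat.reduceAdd, hsrc, htgt] at v0 v1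
      cases e0 : p.kind 0 <;> cases e1 : p.kind 1 <;> simp [e0, e1] at v0 v1 c1
      · exact ⟨p.vert 1, Or.inr ⟨a, ha, v0⟩, p.vert 1, Or.inr ⟨b, hb, v1⟩, Or.inl rfl⟩
      · exact ⟨p.vert 1, Or.inr ⟨a, ha, v0⟩, b, Or.inl hb, Or.inr v1⟩
      · exact ⟨a, Or.inl ha, p.vert 1, Or.inr ⟨b, hb, v1⟩, Or.inr v0⟩
    · have v0 := hval 0 (by omega)
      have v1 := hval 1 (by omega)
      have v2 := hval 2 (by omega)
      have c1 := hcol 1 (by omega) (by omega)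
      have c2 := hcol 2 (by omega) (by omega)
      simp only [zero_add, Nat.reduceAdd, hsrc, htgt] at v0 v1 v2
      cases e0 : p.kind 0 <;> cases e1 : p.kind 1 <;> cases e2 : p.kind 2 <;>
        simp [e0, e1, e2] at v0 v1 v2 c1 c2
      exact ⟨p.vert 1, Or.inr ⟨a, ha, v0⟩, p.vert 2, Or.inr ⟨b, hb, v2⟩, Or.inr v1⟩
  · rintro ⟨x, hx, y, hy, hxy⟩
    obtain ⟨b, hb, p, hp, hp0⟩ : ∃ b ∈ B, ∃ p : MGPath G y b, p.pureCollider ∧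
        (0 < p.n → p.kind 0 = EdgeKind.bwd) := by
      obtain hy | ⟨b, hb, hby⟩ := hy
      · exact ⟨y, hy, .nil G y, fun j _ hjn => absurd hjn (Nat.not_lt_zero j),
          fun h => absurd h (lt_irrefl 0)⟩
      · exact ⟨b, hb, .cons .bwd (by simpa using hby) (.nil G b),
          fun j hj hjn => absurd hjn (Nat.not_lt.mpr hj), fun _ => rfl⟩
    obtain ⟨q, hq, hq0⟩ : ∃ q : MGPath G x b, q.pureCollider ∧
        (0 < q.n → q.kind 0 ≠ EdgeKind.fwd) := by
      obtain rfl | hxy := hxy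
      · exact ⟨p, hp, fun h => by simp [hp0 h]⟩
      · exact ⟨.cons .un (by simpa using hxy) p,
          MGPath.pureCollider_cons hp fun h => by simp [hp0 h], fun _ => EdgeKind.noConfusion⟩
    obtain hx | ⟨a, ha, hax⟩ := hx
    · exact ⟨x, hx, b, hb, q, hq⟩
    · exact ⟨a, ha, b, hb, .cons .fwd (by simpa using hax) q,
        MGPath.pureCollider_cons hq fun h => by simp [hq0 h]⟩

theorem pSeparated_compl_iff_forall_not_pureCollider {V : Type*} {G : MixedGraph V}
    {A B : Set V} :
    pSeparated G A B (A ∪ B)ᶜ ↔ ∀ a ∈ A, ∀ b ∈ B, ∀ p : MGPath G a b, ¬p.pureCollider := by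
  constructor
  · intro h a ha b hb p hp
    obtain ⟨a', ha', b', hb', q, hq, hqS⟩ :=
      p.exists_pureCollider_of_colliderAt_or_mem ha hb fun j hj hjn => Or.inl (hp j hj hjn)
    exact h a' ha' b' hb' q fun j hj hjn =>
      ⟨fun _ => hqS j hj hjn, fun hc => absurd (hq j hj hjn) hc⟩
  · intro h a ha b hb p hp
    obtain ⟨a', ha', b', hb', q, hq, -⟩ :=
      p.exists_pureCollider_of_colliderAt_or_mem ha hb fun j hj hjn =>
        or_iff_not_imp_left.mpr fun hc => Set.notMem_compl_iff.mp ((hp j hj hjn).2 hc)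
    exact h a' ha' b' hb' q hq

/-- Lemma: characterizations of p-separation given the complement.
For a mixed graph `G` and disjoint `A, B ⊆ V`, the following are equivalent:
(i) `A` and `B` are p-separated given `V ∖ (A ∪ B)`;
(ii) there is no pure-collider path between `A` and `B`;
(iii) `(A ∪ ch(A)) ∩ (B ∪ ch(B)) = ∅` and `ne(A ∪ ch(A)) ∩ (B ∪ ch(B)) = ∅`. -/
theorem pSeparation_complement_characterization
    {V : Type*} (G : MixedGraph V) (A B : Set V) (hAB : Disjoint A B) :
    (pSeparated G A B (A ∪ B)ᶜ ↔
      ∀ a ∈ A, ∀ b ∈ B, ∀ p : MGPath G a b, ¬p.pureCollider) ∧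
    (pSeparated G A B (A ∪ B)ᶜ ↔
      ((A ∪ G.ch A) ∩ (B ∪ G.ch B) = ∅ ∧
        G.nb (A ∪ G.ch A) ∩ (B ∪ G.ch B) = ∅)) := by
  refine ⟨pSeparated_compl_iff_forall_not_pureCollider, ?_⟩
  rw [pSeparated_compl_iff_forall_not_pureCollider,
    MixedGraph.inter_eq_empty_and_nb_inter_eq_empty_iff]
  simpa only [not_exists, not_and] using not_congr (exists_pureCollider_iff (G := G))

end GraphicalTS
end
end
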